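/- Let α = (α₁,…,α_r) be a type-B composition of n. Then the number of inversions of the longest element ω_{o;α} of H_α satisfies |Inv(ω_{o;α})| = n² − Σ_{i=1}^r α_i(α_i−1)/2 − (α₁+1)α₁/2 if α is join, and |Inv(ω_{o;α})| = n² − Σ_{i=1}^r α_i(α_i−1)/2 if α is split. -/

import Mathlib

namespace TypeB

/-- A sign-symmetric permutation of degree `n`: a bijection of `ℤ` with
`π(-i) = -π(i)` which fixes every integer of absolute value `> n`.
It restricts to a sign-symmetric permutation of `±[n]`. -/
structure SignedPerm (n : ℕ) where
  perm : Equiv.Perm ℤ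
  sign_symm : ∀ i : ℤ, perm (-i) = - perm i
  outside : ∀ i : ℤ, (n : ℤ) < |i| → perm i = i

/-- Symbols for type-B inversions: `neg i` is `[i]`, `pair i j` (with `i < j`)
is `(i,j)`, and `mixed i j` (with `i < j`) is `(−j, i)`. -/
inductive BInv (n : ℕ) : Type where
  | neg : ℕ → BInv n
  | pair : ℕ → ℕ → BInv n
  | mixed : ℕ → ℕ → BInv n
deriving DecidableEq

/-- `i⁺`: `i+1` if `i ≠ -1`, and `1` for `i = -1`. -/
def iplus (i : ℤ) : ℤ := if i = -1 then 1 else i + 1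

/-- The inversion set of a sign-symmetric permutation. -/
def Inv {n : ℕ} (π : SignedPerm n) : Set (BInv n) := fun t =>
  match t with
  | .neg i => 1 ≤ i ∧ i ≤ n ∧ π.perm (i : ℤ) < 0
  | .pair i j => 1 ≤ i ∧ i < j ∧ j ≤ n ∧ π.perm (j : ℤ) < π.perm (i : ℤ)
  | .mixed i j => 1 ≤ i ∧ i < j ∧ j ≤ n ∧ π.perm (i : ℤ) + π.perm (j : ℤ) < 0

/-- The cover-inversion set of a sign-symmetric permutation. -/
def Cov {n : ℕ} (π : SignedPerm n) : Set (BInv n) := fun t =>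
  match t with
  | .neg i => 1 ≤ i ∧ i ≤ n ∧ π.perm (i : ℤ) = -1
  | .pair i j => 1 ≤ i ∧ i < j ∧ j ≤ n ∧ π.perm (i : ℤ) = iplus (π.perm (j : ℤ))
  | .mixed i j => 1 ≤ i ∧ i < j ∧ j ≤ n ∧ π.perm (-(j : ℤ)) = iplus (π.perm (i : ℤ))

/-- The symbol `(−j, i)` in canonical form (it equals `(−i, j)`). -/
def mixedInv {n : ℕ} (i j : ℕ) : BInv n := .mixed (min i j) (max i j)

/-- A type-B composition of `n`: positive parts summing to `n`,
together with a split/join label. -/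
structure BComp (n : ℕ) where
  parts : List ℕ
  pos : ∀ a ∈ parts, 0 < a
  sum_eq : parts.sum = n
  isJoin : Bool

/-- The partial sum `p_i = α₁ + ⋯ + α_i`. -/
def pSum {n : ℕ} (α : BComp n) (i : ℕ) : ℕ := (α.parts.take i).sum

/-- The α-region of `a ∈ [n]`: the unique `i` with `p_{i-1} < a ≤ p_i`. -/
def region {n : ℕ} (α : BComp n) (a : ℕ) : ℕ :=
  ((Finset.range α.parts.length).filter (fun j => pSum α j < a)).card

/-- The first part `α₁` of a type-B composition. -/
def alpha1 {n : ℕ} (α : BComp n) : ℕ := α.parts.headI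

/-- Index of the block of `Part(α)` containing `x ∈ ±[n]`; two elements lie in
a common block of `Part(α)` iff their indices agree. -/
def blockIdx {n : ℕ} (α : BComp n) (x : ℤ) : ℤ :=
  if 0 < x then
    (if α.isJoin = true ∧ region α x.toNat = 1 then 0 else (region α x.toNat : ℤ))
  else
    (if α.isJoin = true ∧ region α (-x).toNat = 1 then 0 else -(region α (-x).toNat : ℤ))

/-- Membership in `±[n]`. -/
def inPM (n : ℕ) (x : ℤ) : Prop := x ≠ 0 ∧ -(n : ℤ) ≤ x ∧ x ≤ (n : ℤ)

/-- `π ∈ H_α`: `π` is increasing on every block of `Part(α)`. -/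
def memH {n : ℕ} (α : BComp n) (π : SignedPerm n) : Prop :=
  ∀ a b : ℤ, inPM n a → inPM n b → a < b → blockIdx α a = blockIdx α b →
    π.perm a < π.perm b

/-- Common part of the type-B `(α,231)`- and `(α,312)`-patterns: indices
`i < j < k` in `±[n]`, in pairwise distinct blocks of `Part(α)`, with `j > 0`
and `π(i) = π(k)⁺`. -/
def patternCore {n : ℕ} (α : BComp n) (π : SignedPerm n) (i j k : ℤ) : Prop :=
  inPM n i ∧ inPM n j ∧ inPM n k ∧ i < j ∧ j < k ∧ 0 < j ∧
  blockIdx α i ≠ blockIdx α j ∧ blockIdx α j ≠ blockIdx α k ∧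
  blockIdx α i ≠ blockIdx α k ∧ π.perm i = iplus (π.perm k)

/-- `π` has a type-B `(α,231)`-split (resp. -join) pattern, according to the
label of `α`. -/
def has231 {n : ℕ} (α : BComp n) (π : SignedPerm n) : Prop :=
  ∃ i j k : ℤ, patternCore α π i j k ∧
    (if α.isJoin = true then
       (((alpha1 α : ℤ) < j → π.perm i < π.perm j) ∧
        (j ≤ (alpha1 α : ℤ) → π.perm j < π.perm k))
     else π.perm i < π.perm j)

/-- `π` has a type-B `(α,312)`-split (resp. -join) pattern, according to the
label of `α`. -/
def has312 {n : ℕ} (α : BComp n) (π : SignedPerm n) : Prop :=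
  ∃ i j k : ℤ, patternCore α π i j k ∧
    (if α.isJoin = true then
       (((alpha1 α : ℤ) < j → π.perm j < π.perm k) ∧
        (j ≤ (alpha1 α : ℤ) → π.perm i < π.perm j))
     else π.perm j < π.perm k)

/-- `π ∈ H_α(231)`. -/
def mem231 {n : ℕ} (α : BComp n) (π : SignedPerm n) : Prop := memH α π ∧ ¬ has231 α π

/-- `π ∈ H_α(312)`. -/
def mem312 {n : ℕ} (α : BComp n) (π : SignedPerm n) : Prop := memH α π ∧ ¬ has312 α π

/-- The set `H_α`. -/
def Hset {n : ℕ} (α : BComp n) : Set (SignedPerm n) := {π | memH α π}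

/-- The carrier of `Tam_B(α)`, namely `H_α(231)`. -/
def Tset {n : ℕ} (α : BComp n) : Set (SignedPerm n) := {π | mem231 α π}

/-- The weak order: inclusion of inversion sets. -/
def wle {n : ℕ} (π σ : SignedPerm n) : Prop := Inv π ⊆ Inv σ

/-- `m` is the greatest lower bound of `x` and `y` within `P`, w.r.t. the weak order. -/
def isMeetIn {n : ℕ} (P : Set (SignedPerm n)) (x y m : SignedPerm n) : Prop :=
  m ∈ P ∧ wle m x ∧ wle m y ∧ ∀ z ∈ P, wle z x → wle z y → wle z m

/-- `u` is the least upper bound of `x` and `y` within `P`, w.r.t. the weak order. -/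
def isJoinIn {n : ℕ} (P : Set (SignedPerm n)) (x y u : SignedPerm n) : Prop :=
  u ∈ P ∧ wle x u ∧ wle y u ∧ ∀ z ∈ P, wle x z → wle y z → wle u z

/-- `d = Π↓(π)`: `d` is the greatest element of `{σ ∈ H_α(231) : Inv σ ⊆ Inv π}`. -/
def isProjDown {n : ℕ} (α : BComp n) (π d : SignedPerm n) : Prop :=
  mem231 α d ∧ wle d π ∧ ∀ σ, mem231 α σ → wle σ π → wle σ d

/-- `d = Π†(π)`: `d` is the greatest element of `{σ ∈ H_α(312) : Inv σ ⊆ Inv π}`. -/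
def isProjDagger {n : ℕ} (α : BComp n) (π d : SignedPerm n) : Prop :=
  mem312 α d ∧ wle d π ∧ ∀ σ, mem312 α σ → wle σ π → wle σ d

/-- The value `ω_{o;α}(a)` for `a ∈ [n]`. -/
def omegaPos {n : ℕ} (α : BComp n) (a : ℕ) : ℤ :=
  if α.isJoin = true ∧ region α a = 1 then (a : ℤ)
  else -(((pSum α (region α a) : ℤ) + (pSum α (region α a - 1) : ℤ) + 1) - (a : ℤ))

/-- The longest element `ω_{o;α}` of `H_α`, as a function on `ℤ`. -/
def omegaFun {n : ℕ} (α : BComp n) (x : ℤ) : ℤ :=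
  if 0 < x ∧ x ≤ (n : ℤ) then omegaPos α x.toNat
  else if 0 < -x ∧ -x ≤ (n : ℤ) then -(omegaPos α (-x).toNat)
  else x

/-- The set of `m` such that there is a strict chain `x₀ < x₁ < ⋯ < x_m` in `P`. -/
def chainLengths {n : ℕ} (P : Set (SignedPerm n)) : Set ℕ :=
  {m | ∃ f : Fin (m + 1) → SignedPerm n, (∀ i, f i ∈ P) ∧
        ∀ i j : Fin (m + 1), i < j → Inv (f i) ⊂ Inv (f j)}

/-- `x` is join-irreducible in `Tam_B(α)`. -/
def joinIrred {n : ℕ} (α : BComp n) (x : SignedPerm n) : Prop :=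
  x ∈ Tset α ∧ ¬ (∀ y ∈ Tset α, wle x y) ∧
  ∀ y z, y ∈ Tset α → z ∈ Tset α → isJoinIn (Tset α) y z x → x = y ∨ x = z

/-- `x` is meet-irreducible in `Tam_B(α)`. -/
def meetIrred {n : ℕ} (α : BComp n) (x : SignedPerm n) : Prop :=
  x ∈ Tset α ∧ ¬ (∀ y ∈ Tset α, wle y x) ∧
  ∀ y z, y ∈ Tset α → z ∈ Tset α → isMeetIn (Tset α) y z x → x = y ∨ x = z

/-- `x` is left modular in the lattice on `P`: `(r ∨ x) ∧ q = r ∨ (x ∧ q)`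
for all `r ≤ q` in `P`. -/
def leftModular {n : ℕ} (P : Set (SignedPerm n)) (x : SignedPerm n) : Prop :=
  ∀ r q, r ∈ P → q ∈ P → wle r q →
    ∀ u v w1 w2, isJoinIn P r x u → isMeetIn P u q v →
      isMeetIn P x q w1 → isJoinIn P r w1 w2 → v = w2

/-- The simple generator `s_i` as a function on `ℤ`: `s₀` exchanges `1` and `-1`,
and for `i ≥ 1`, `s_i` exchanges `i` with `i+1` and `-i` with `-(i+1)`. -/
def sfun (i : ℕ) (x : ℤ) : ℤ :=
  if i = 0 then (if x = 1 then -1 else if x = -1 then 1 else x)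
  else if x = (i : ℤ) then (i : ℤ) + 1
  else if x = (i : ℤ) + 1 then (i : ℤ)
  else if x = -(i : ℤ) then -(i : ℤ) - 1
  else if x = -(i : ℤ) - 1 then -(i : ℤ)
  else x

/-- `i` is one of the partial sums `p₁, …, p_{r−1}` of `α`. -/
def isPSum {n : ℕ} (α : BComp n) (i : ℕ) : Prop :=
  ∃ j : ℕ, 1 ≤ j ∧ j < α.parts.length ∧ pSum α j = i

/-- `n² − Σᵢ α_i(α_i−1)/2`, minus additionally `(α₁+1)α₁/2` when `α` is join. -/
def lengthFormula {n : ℕ} (α : BComp n) : ℕ :=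
  n ^ 2 - (α.parts.map (fun a => a * (a - 1) / 2)).sum -
    (if α.isJoin = true then (alpha1 α + 1) * alpha1 α / 2 else 0)

/-- A finite lower set of natural numbers is an initial segment. -/
lemma eq_range_card_of_lower (s : Finset ℕ) (h : ∀ a ∈ s, ∀ b < a, b ∈ s) :
    s = Finset.range s.card := by
  apply Finset.eq_of_subset_of_card_le
  · intro m hm
    have hsub : Finset.range (m + 1) ⊆ s := by
      intro b hb
      rcases Nat.lt_succ_iff_lt_or_eq.1 (Finset.mem_range.1 hb) with hlt | rfl
      · exact h m hm b hlt
      · exact hm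
    simpa using Finset.card_le_card hsub
  · simp

/-- The increasing pairs of elements of `s`. -/
def ltPairs (s : Finset ℕ) : Finset (ℕ × ℕ) := (s ×ˢ s).filter fun p => p.1 < p.2

@[simp]
lemma mem_ltPairs {s : Finset ℕ} {p : ℕ × ℕ} :
    p ∈ ltPairs s ↔ (p.1 ∈ s ∧ p.2 ∈ s) ∧ p.1 < p.2 := by
  simp [ltPairs]

lemma card_ltPairs (s : Finset ℕ) : (ltPairs s).card = s.card.choose 2 := by
  induction s using Finset.induction_on_max with
  | empty => rfl
  | insert m s hm ih =>
    have hms : m ∉ s := fun h => lt_irrefl _ (hm m h)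
    have hins : ltPairs (insert m s) = ltPairs s ∪ s.image (fun a => (a, m)) := by
      ext ⟨a, b⟩
      simp only [mem_ltPairs, Finset.mem_insert, Finset.mem_union, Finset.mem_image,
        Prod.mk.injEq]
      grind
    have hdisj : Disjoint (ltPairs s) (s.image (fun a => (a, m))) := by
      rw [Finset.disjoint_left]
      rintro ⟨a, b⟩ hab hab'
      simp only [mem_ltPairs, Finset.mem_image, Prod.mk.injEq] at hab hab'
      grind
    rw [hins, Finset.card_union_of_disjoint hdisj, ih, Finset.card_insert_of_notMem hms,
      Finset.card_image_of_injective _ (fun a b h => (Prod.mk.inj h).1), Nat.choose_succ_succ' _ 1]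
    simp [add_comm]

section Region

variable {n : ℕ} (α : BComp n)

lemma pSum_succ {k : ℕ} (hk : k < α.parts.length) :
    pSum α (k + 1) = pSum α k + α.parts[k] :=
  List.sum_take_succ _ _ hk

lemma pSum_mono : Monotone (pSum α) := by
  refine monotone_nat_of_le_succ fun k => ?_
  by_cases hk : k < α.parts.length
  · rw [pSum_succ α hk]
    omega
  · simp [pSum, List.take_of_length_le (not_lt.1 hk),
      List.take_of_length_le ((not_lt.1 hk).trans k.le_succ)]

lemma pSum_zero : pSum α 0 = 0 := by simp [pSum]

lemma pSum_of_length_le {k : ℕ} (hk : α.parts.length ≤ k) : pSum α k = n := by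
  rw [pSum, List.take_of_length_le hk, α.sum_eq]

lemma pSum_le (k : ℕ) : pSum α k ≤ n :=
  (pSum_mono α (le_max_left k α.parts.length)).trans_eq (pSum_of_length_le α (le_max_right _ _))

lemma pSum_one : pSum α 1 = alpha1 α := by
  unfold pSum alpha1
  cases α.parts <;> simp

lemma lt_region_iff (a k : ℕ) : k < region α a ↔ k < α.parts.length ∧ pSum α k < a := by
  have h := eq_range_card_of_lower
    ((Finset.range α.parts.length).filter fun j => pSum α j < a) (by
      intro x hx y hy
      simp only [Finset.mem_filter, Finset.mem_range] at hx ⊢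
      exact ⟨hy.trans hx.1, (pSum_mono α hy.le).trans_lt hx.2⟩)
  have hk := Finset.ext_iff.1 h k
  simp only [Finset.mem_filter, Finset.mem_range] at hk
  exact hk.symm

lemma region_spec {a : ℕ} (ha : 1 ≤ a) (han : a ≤ n) :
    1 ≤ region α a ∧ region α a ≤ α.parts.length ∧
      pSum α (region α a - 1) < a ∧ a ≤ pSum α (region α a) := by
  have hpos : 0 < region α a := by
    rw [lt_region_iff, pSum_zero]
    refine ⟨Nat.pos_of_ne_zero fun h => ?_, ha⟩
    have := pSum_of_length_le α h.le
    rw [pSum_zero] at this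
    omega
  have h1 := (lt_region_iff α a (region α a - 1)).1 (by omega)
  refine ⟨hpos, by omega, h1.2, ?_⟩
  by_contra! h
  refine lt_irrefl _ ((lt_region_iff α a (region α a)).2 ⟨?_, h⟩)
  by_contra! h'
  rw [pSum_of_length_le α h'] at h
  omega

lemma region_mono : Monotone (region α) := by
  intro a b hab
  by_contra! h
  have h1 := (lt_region_iff α a _).1 h
  exact lt_irrefl _ ((lt_region_iff α b _).2 ⟨h1.1, h1.2.trans_le hab⟩)

lemma region_eq_succ_iff {a k : ℕ} (ha : 1 ≤ a) (han : a ≤ n) :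
    region α a = k + 1 ↔ pSum α k < a ∧ a ≤ pSum α (k + 1) := by
  obtain ⟨h1, h2, h3, h4⟩ := region_spec α ha han
  constructor
  · intro h
    rw [h] at h3 h4
    exact ⟨h3, h4⟩
  · rintro ⟨hl, hu⟩
    by_contra hne
    rcases lt_or_gt_of_ne hne with h | h
    · have := pSum_mono α (show region α a ≤ k by omega)
      omega
    · have := pSum_mono α (show k + 1 ≤ region α a - 1 by omega)
      omega

lemma region_eq_one_iff {a : ℕ} (ha : 1 ≤ a) (han : a ≤ n) :
    region α a = 1 ↔ a ≤ alpha1 α := by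
  rw [region_eq_succ_iff α ha han (k := 0), pSum_zero, zero_add, pSum_one]
  omega

lemma alpha1_le : alpha1 α ≤ n :=
  pSum_one α ▸ pSum_le α 1

/-- The number of increasing pairs within a common region. -/
lemma card_same_region :
    ((ltPairs (Finset.Icc 1 n)).filter fun p => region α p.1 = region α p.2).card =
      (α.parts.map (fun a => a * (a - 1) / 2)).sum := by
  rw [Finset.card_eq_sum_card_fiberwise (f := fun p => region α p.1 - 1)
    (t := Finset.range α.parts.length), Finset.sum_range, ← Fin.sum_univ_fun_getElem]
  · refine Finset.sum_congr rfl fun k _ => ?_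
    have hs := pSum_succ α k.2
    have hle := pSum_le α (k + 1)
    have heq : (((ltPairs (Finset.Icc 1 n)).filter fun p => region α p.1 = region α p.2).filter
        fun p => region α p.1 - 1 = k) = ltPairs (Finset.Ioc (pSum α k) (pSum α (k + 1))) := by
      ext ⟨a, b⟩
      simp only [Finset.mem_filter, mem_ltPairs, Finset.mem_Icc, Finset.mem_Ioc]
      constructor
      · rintro ⟨⟨⟨⟨ha, hb⟩, hab⟩, hr⟩, hk⟩
        have h1 := (region_spec α ha.1 ha.2).1
        exact ⟨⟨(region_eq_succ_iff α ha.1 ha.2).1 (by omega),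
          (region_eq_succ_iff α hb.1 hb.2).1 (by omega)⟩, hab⟩
      · rintro ⟨⟨ha, hb⟩, hab⟩
        have h1 := (region_eq_succ_iff α (by omega) (by omega)).2 ha
        have h2 := (region_eq_succ_iff α (by omega) (by omega)).2 hb
        omega
    rw [heq, card_ltPairs, Nat.card_Ioc, hs, Nat.add_sub_cancel_left, Nat.choose_two_right]
  · rintro ⟨a, b⟩ h
    simp only [Finset.coe_filter, Set.mem_ofPred_eq, mem_ltPairs, Finset.mem_Icc] at h
    have := region_spec α h.1.1.1.1 h.1.1.1.2
    simp only [Finset.coe_range, Set.mem_Iio]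
    omega

lemma omegaFun_natCast {a : ℕ} (ha : 1 ≤ a) (han : a ≤ n) : omegaFun α a = omegaPos α a := by
  rw [omegaFun, if_pos (by omega), Int.toNat_natCast]

lemma omegaPos_of_mem {a : ℕ} (h : α.isJoin = true ∧ region α a = 1) : omegaPos α a = a :=
  if_pos h

/-- On a reversed block, `omegaPos` takes values in the negative of that block. -/
lemma omegaPos_of_not_mem {a : ℕ} (ha : 1 ≤ a) (han : a ≤ n)
    (h : ¬ (α.isJoin = true ∧ region α a = 1)) :
    omegaPos α a = a - pSum α (region α a) - pSum α (region α a - 1) - 1 ∧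
      -(pSum α (region α a) : ℤ) ≤ omegaPos α a ∧
      omegaPos α a < -(pSum α (region α a - 1) : ℤ) := by
  have := region_spec α ha han
  rw [omegaPos, if_neg h]
  omega

lemma omegaPos_neg_iff {a : ℕ} (ha : 1 ≤ a) (han : a ≤ n) :
    omegaPos α a < 0 ↔ ¬ (α.isJoin = true ∧ region α a = 1) := by
  by_cases h : α.isJoin = true ∧ region α a = 1
  · simp [omegaPos_of_mem α h, h]
  · have := omegaPos_of_not_mem α ha han h
    simp only [h, not_false_eq_true, iff_true]
    omega

lemma omegaPos_lt_iff {a b : ℕ} (ha : 1 ≤ a) (hab : a < b) (hb : b ≤ n) :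
    omegaPos α b < omegaPos α a ↔ ¬ region α a = region α b := by
  by_cases hr : region α a = region α b
  · simp only [hr, not_true_eq_false, iff_false, not_lt, omegaPos]
    split_ifs <;> omega
  · have hlt : region α a < region α b := lt_of_le_of_ne (region_mono α hab.le) hr
    have h1 := (region_spec α ha (by omega)).1
    simp only [hr, not_false_eq_true, iff_true]
    have hB := omegaPos_of_not_mem α (a := b) (by omega) hb (by omega)
    by_cases h : α.isJoin = true ∧ region α a = 1
    · rw [omegaPos_of_mem α h]
      omega
    · have hA := omegaPos_of_not_mem α ha (by omega) h
      have := pSum_mono α (show region α a ≤ region α b - 1 by omega)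
      omega

lemma omegaPos_add_neg_iff {a b : ℕ} (ha : 1 ≤ a) (hab : a < b) (hb : b ≤ n) :
    omegaPos α a + omegaPos α b < 0 ↔ ¬ (α.isJoin = true ∧ region α b = 1) := by
  by_cases hB : α.isJoin = true ∧ region α b = 1
  · have h1 := (region_spec α ha (by omega)).1
    have h2 := region_mono α hab.le
    rw [omegaPos_of_mem α hB, omegaPos_of_mem α ⟨hB.1, by omega⟩]
    simp only [hB, and_self, not_true_eq_false, iff_false]
    omega
  · simp only [hB, not_false_eq_true, iff_true]
    have hB' := omegaPos_of_not_mem α (by omega) hb hB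
    by_cases h : α.isJoin = true ∧ region α a = 1
    · have hs := region_spec α ha (by omega)
      have hs' := region_spec α (a := b) (by omega) hb
      have : region α b ≠ 1 := fun h' => hB ⟨h.1, h'⟩
      have hm := pSum_mono α (show region α a ≤ region α b - 1 by omega)
      rw [omegaPos_of_mem α h]
      omega
    · have hA := omegaPos_of_not_mem α ha (by omega) h
      omega

lemma card_join_singles :
    ((Finset.Icc 1 n).filter fun a => α.isJoin = true ∧ region α a = 1).card =
      if α.isJoin = true then alpha1 α else 0 := by
  split_ifs with hj
  · have : ((Finset.Icc 1 n).filter fun a => α.isJoin = true ∧ region α a = 1) =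
        Finset.Icc 1 (alpha1 α) := by
      ext a
      have := alpha1_le α
      simp only [Finset.mem_filter, Finset.mem_Icc]
      constructor
      · rintro ⟨h, h'⟩
        exact ⟨h.1, (region_eq_one_iff α h.1 h.2).1 h'.2⟩
      · intro h
        exact ⟨⟨h.1, by omega⟩, hj, (region_eq_one_iff α h.1 (by omega)).2 h.2⟩
    rw [this, Nat.card_Icc, Nat.add_sub_cancel]
  · simp [hj]

lemma card_join_pairs :
    ((ltPairs (Finset.Icc 1 n)).filter fun p => α.isJoin = true ∧ region α p.2 = 1).card =
      if α.isJoin = true then (alpha1 α).choose 2 else 0 := by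
  split_ifs with hj
  · have : ((ltPairs (Finset.Icc 1 n)).filter fun p => α.isJoin = true ∧ region α p.2 = 1) =
        ltPairs (Finset.Icc 1 (alpha1 α)) := by
      ext ⟨a, b⟩
      have := alpha1_le α
      simp only [Finset.mem_filter, mem_ltPairs, Finset.mem_Icc]
      constructor
      · rintro ⟨⟨⟨ha, hb⟩, hab⟩, h'⟩
        have := (region_eq_one_iff α hb.1 hb.2).1 h'.2
        omega
      · intro h
        have := (region_eq_one_iff α (a := b) (by omega) (by omega)).2 (by omega)
        exact ⟨by omega, hj, this⟩
    rw [this, card_ltPairs, Nat.card_Icc, Nat.add_sub_cancel]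
  · simp [hj]

/-- The inversion set as a finite set, for a permutation agreeing with `omegaFun`. -/
lemma inv_eq (w : SignedPerm n) (hw : ∀ x : ℤ, w.perm x = omegaFun α x) :
    Inv w = ((((Finset.Icc 1 n).filter
          fun a => ¬ (α.isJoin = true ∧ region α a = 1)).image BInv.neg ∪
        (((ltPairs (Finset.Icc 1 n)).filter
          fun p => ¬ region α p.1 = region α p.2).image fun p => BInv.pair p.1 p.2) ∪
        (((ltPairs (Finset.Icc 1 n)).filter
          fun p => ¬ (α.isJoin = true ∧ region α p.2 = 1)).image
            fun p => BInv.mixed p.1 p.2) : Finset (BInv n)) : Set (BInv n)) := by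
  ext t
  rw [Finset.mem_coe, Finset.mem_union, Finset.mem_union, Finset.mem_image, Finset.mem_image,
    Finset.mem_image]
  cases t with
  | neg i =>
    change (1 ≤ i ∧ i ≤ n ∧ w.perm (i : ℤ) < 0) ↔ _
    simp only [Finset.mem_filter, Finset.mem_Icc, BInv.neg.injEq, reduceCtorEq, and_false,
      exists_false, or_false]
    rw [exists_eq_right, and_assoc]
    refine and_congr_right fun h1 => and_congr_right fun h2 => ?_
    rw [hw, omegaFun_natCast α h1 h2, omegaPos_neg_iff α h1 h2]
  | pair i j =>
    change (1 ≤ i ∧ i < j ∧ j ≤ n ∧ w.perm (j : ℤ) < w.perm (i : ℤ)) ↔ _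
    simp only [Finset.mem_filter, mem_ltPairs, Finset.mem_Icc, BInv.pair.injEq, reduceCtorEq,
      and_false, exists_false, or_false, false_or, Prod.exists]
    have key (h1 : 1 ≤ i) (h2 : i < j) (h3 : j ≤ n) :
        w.perm (j : ℤ) < w.perm (i : ℤ) ↔ ¬ region α i = region α j := by
      rw [hw, hw, omegaFun_natCast α h1 (by omega), omegaFun_natCast α (by omega) h3,
        omegaPos_lt_iff α h1 h2 h3]
    constructor
    · rintro ⟨h1, h2, h3, h4⟩
      exact ⟨i, j, ⟨by omega, (key h1 h2 h3).1 h4⟩, rfl, rfl⟩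
    · rintro ⟨a, b, ⟨h, h4⟩, rfl, rfl⟩
      exact ⟨by omega, by omega, by omega, (key (by omega) (by omega) (by omega)).2 h4⟩
  | mixed i j =>
    change (1 ≤ i ∧ i < j ∧ j ≤ n ∧ w.perm (i : ℤ) + w.perm (j : ℤ) < 0) ↔ _
    simp only [Finset.mem_filter, mem_ltPairs, Finset.mem_Icc, BInv.mixed.injEq, reduceCtorEq,
      and_false, exists_false, false_or, Prod.exists]
    have key (h1 : 1 ≤ i) (h2 : i < j) (h3 : j ≤ n) :
        w.perm (i : ℤ) + w.perm (j : ℤ) < 0 ↔ ¬ (α.isJoin = true ∧ region α j = 1) := by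
      rw [hw, hw, omegaFun_natCast α h1 (by omega), omegaFun_natCast α (by omega) h3,
        omegaPos_add_neg_iff α h1 h2 h3]
    constructor
    · rintro ⟨h1, h2, h3, h4⟩
      exact ⟨i, j, ⟨by omega, (key h1 h2 h3).1 h4⟩, rfl, rfl⟩
    · rintro ⟨a, b, ⟨h, h4⟩, rfl, rfl⟩
      exact ⟨by omega, by omega, by omega, (key (by omega) (by omega) (by omega)).2 h4⟩

end Region

/-- The number of inversions of the longest element
`ω_{o;α}` of `H_α` equals `n² − Σᵢ αᵢ(αᵢ−1)/2 − (α₁+1)α₁/2` if `α` is join,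
and `n² − Σᵢ αᵢ(αᵢ−1)/2` if `α` is split. -/
theorem omega_inv_card (n : ℕ) (hn : 1 ≤ n) (α : BComp n)
    (w : SignedPerm n) (hw : ∀ x : ℤ, w.perm x = omegaFun α x) :
    (Inv w).ncard = lengthFormula α := by
  have hpair : Function.Injective fun p : ℕ × ℕ => (BInv.pair p.1 p.2 : BInv n) := by
    rintro ⟨a, b⟩ ⟨c, d⟩ h
    simpa using h
  have hmixed : Function.Injective fun p : ℕ × ℕ => (BInv.mixed p.1 p.2 : BInv n) := by
    rintro ⟨a, b⟩ ⟨c, d⟩ h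
    simpa using h
  have hneg : Function.Injective (BInv.neg : ℕ → BInv n) := fun a b h => by simpa using h
  rw [inv_eq α w hw, Set.ncard_coe_finset, Finset.card_union_of_disjoint,
    Finset.card_union_of_disjoint, Finset.card_image_of_injective _ hneg,
    Finset.card_image_of_injective _ hpair, Finset.card_image_of_injective _ hmixed]
  · have h1 := Finset.card_filter_add_card_filter_not (s := Finset.Icc 1 n)
      (fun a => α.isJoin = true ∧ region α a = 1)
    have h2 := Finset.card_filter_add_card_filter_not (s := ltPairs (Finset.Icc 1 n))
      (fun p => region α p.1 = region α p.2)
    have h3 := Finset.card_filter_add_card_filter_not (s := ltPairs (Finset.Icc 1 n))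
      (fun p => α.isJoin = true ∧ region α p.2 = 1)
    rw [card_join_singles, Nat.card_Icc, Nat.add_sub_cancel] at h1
    rw [card_same_region, card_ltPairs, Nat.card_Icc, Nat.add_sub_cancel] at h2
    rw [card_join_pairs, card_ltPairs, Nat.card_Icc, Nat.add_sub_cancel] at h3
    have hsq : n ^ 2 = n + 2 * n.choose 2 := by
      rw [Nat.choose_two_right, Nat.mul_div_cancel' (Nat.even_mul_pred_self n).two_dvd]
      cases n with
      | zero => rfl
      | succ m => simp only [Nat.add_sub_cancel]; ring
    have htri : (alpha1 α + 1) * alpha1 α / 2 = alpha1 α + (alpha1 α).choose 2 := by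
      have h := Nat.choose_succ_succ' (alpha1 α) 1
      rwa [Nat.choose_one_right, Nat.choose_two_right (alpha1 α + 1), Nat.add_sub_cancel] at h
    rw [lengthFormula, hsq, htri]
    split_ifs at h1 h3 ⊢ <;> omega
  all_goals
    rw [Finset.disjoint_left]
    intro t ht ht'
    simp only [Finset.mem_union, Finset.mem_image] at ht ht'
    grind

end TypeB
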